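/- arXiv:2301.07208 — 2 statements merged into one kernel-verified Lean document; each statement's English description precedes it below -/
import Mathlib

section
/- Halting bound for progressing trajectory assignments: Let K be an acyclic Kripke structure of depth at most K₀, let φ be an extended A-HLTL formula, let Π be an asynchronous trace assignment assigning to each pair (π,τ) with π ∈ Paths(φ) and τ ∈ Trajs(φ) a pointed trace of K at position 0, and let Γ be a trajectory assignment. Suppose that at every step j ≥ 0 of (Π,Γ), either every pair (π,τ) is at a halting state, or some trajectory moves some non-halted trace, i.e., there exist τ and π with π ∈ Γ(τ)(j) such that halt does not hold at the current position of the trace assigned to (π,τ). Then after at most K₀ · |Paths(φ)| · |Trajs(φ)| steps, every pair (π,τ) is at a halting state (i.e., halted holds at step K₀ · |Paths(φ)| · |Trajs(φ)| and at all later steps). -/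
open Classical

universe u v w

/-- A trace is an infinite sequence of letters (sets of atomic propositions). -/
abbrev Trace (AP : Type u) := ℕ → Set AP

/-- A pointed trace: a trace together with a pointer position. -/
abbrev PTrace (AP : Type u) := Trace AP × ℕ

/-- A trajectory: an infinite sequence of sets of trace variables. -/
abbrev Traj (PV : Type v) := ℕ → Set PV

/-- A trajectory is fair if every trace variable is selected infinitely often. -/
def FairTraj {PV : Type v} (t : Traj PV) : Prop :=
  ∀ (π : PV) (N : ℕ), ∃ j, N ≤ j ∧ π ∈ t j

/-- A Kripke structure over the atomic propositions `AP`. -/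
structure Kripke (AP : Type u) where
  S : Type w
  init : S
  next : S → S → Prop
  total : ∀ s, ∃ s', next s s'
  L : S → Set AP

/-- A path of a Kripke structure: starts at the initial state and follows the
transition relation. -/
def Kripke.IsPath {AP : Type u} (K : Kripke AP) (p : ℕ → K.S) : Prop :=
  p 0 = K.init ∧ ∀ i, K.next (p i) (p (i + 1))

/-- The set of traces of a Kripke structure. -/
def Kripke.Traces {AP : Type u} (K : Kripke AP) : Set (Trace AP) :=
  { σ | ∃ p, K.IsPath p ∧ ∀ i, σ i = K.L (p i) }

/-- A terminal state: its only outgoing transition is the self-loop. -/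
def Kripke.Terminal {AP : Type u} (K : Kripke AP) (s : K.S) : Prop :=
  ∀ s', K.next s s' → s' = s

/-- The Kripke frame is acyclic: the only loops are self-loops on terminal states,
i.e. any state lying on a cycle is terminal. -/
def Kripke.Acyclic {AP : Type u} (K : Kripke AP) : Prop :=
  ∀ s, Relation.TransGen K.next s s → K.Terminal s

/-- The structure has depth at most `k`: every path reaches a terminal state
within `k` steps. -/
def Kripke.DepthLE {AP : Type u} (K : Kripke AP) (k : ℕ) : Prop :=
  ∀ p, K.IsPath p → ∃ j ≤ k, K.Terminal (p j)

/-- Terminal (halting) states are labeled with the halting proposition `hl π`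
of every trace variable `π`. -/
def Kripke.HaltLabeled {AP : Type u} {PV : Type v} (K : Kripke AP) (hl : PV → AP) : Prop :=
  ∀ s, K.Terminal s → ∀ π, hl π ∈ K.L s

/-- A configuration: an asynchronous trace assignment `tr` mapping each pair
`(π, τ)` of a trace variable and a trajectory variable to a pointed trace,
together with a trajectory assignment `tj`. -/
structure Config (AP : Type u) (PV : Type v) (TV : Type w) where
  tr : PV → TV → PTrace AP
  tj : TV → Traj PV

/-- The successor `(Π,Γ)+1`: each trajectory is shifted, and the pointer of the
pair `(π,τ)` advances exactly when `π ∈ Γ(τ)(0)`. -/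
noncomputable def Config.step {AP : Type u} {PV : Type v} {TV : Type w}
    (C : Config AP PV TV) : Config AP PV TV where
  tr := fun π τ => if π ∈ C.tj τ 0 then ((C.tr π τ).1, (C.tr π τ).2 + 1) else C.tr π τ
  tj := fun τ n => C.tj τ (n + 1)

/-- The `n`-th successor `(Π,Γ)+n`. -/
noncomputable def Config.iter {AP : Type u} {PV : Type v} {TV : Type w}
    (C : Config AP PV TV) (n : ℕ) : Config AP PV TV :=
  Config.step^[n] C

/-- `halted`: for every pair `(π,τ)`, the halting proposition holds at the
current position of its pointed trace. -/
def Config.halted {AP : Type u} {PV : Type v} {TV : Type w}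
    (hl : PV → AP) (C : Config AP PV TV) : Prop :=
  ∀ π τ, hl π ∈ (C.tr π τ).1 (C.tr π τ).2

/-- `off`: some pair `(π,τ)` has its position beyond `k` while its trace does
not halt at position `k`. -/
def Config.off {AP : Type u} {PV : Type v} {TV : Type w}
    (hl : PV → AP) (k : ℕ) (C : Config AP PV TV) : Prop :=
  ∃ π τ, k < (C.tr π τ).2 ∧ hl π ∉ (C.tr π τ).1 k

/-- Rebind a trace variable `π` to the pointed trace `(σ, 0)` for all trajectory
variables. -/
noncomputable def Config.bindTr {AP : Type u} {PV : Type v} {TV : Type w}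
    (C : Config AP PV TV) (π : PV) (σ : Trace AP) : Config AP PV TV where
  tr := fun π' τ => if π' = π then (σ, 0) else C.tr π' τ
  tj := C.tj

/-- Rebind a trajectory variable `τ` to the trajectory `t`. -/
noncomputable def Config.bindTj {AP : Type u} {PV : Type v} {TV : Type w}
    (C : Config AP PV TV) (τ : TV) (t : Traj PV) : Config AP PV TV where
  tr := C.tr
  tj := fun τ' => if τ' = τ then t else C.tj τ'

/-- halting bound for progressing trajectory assignments.
Let `K` be an acyclic Kripke structure of depth at most `K₀`, with terminal
states labeled `halt` and with `halt` persistent along traces.  Let `C = (Π,Γ)`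
be a configuration whose trace assignment assigns to each pair `(π,τ)` a
pointed trace of `K` at position `0` (the trace variables and trajectory
variables being the finite types `PV` and `TV`).  If at every step `j` either
every pair is at a halting state, or some trajectory moves some non-halted
trace, then after at most `K₀ · |PV| · |TV|` steps every pair is at a halting
state. -/
theorem halting_bound {AP : Type u} {PV : Type v} {TV : Type w}
    [Fintype PV] [Fintype TV]
    (K : Kripke AP) (hl : PV → AP) (K₀ : ℕ)
    (hacyc : K.Acyclic) (hdepth : K.DepthLE K₀) (hhalt : K.HaltLabeled hl)
    (hpersist : ∀ σ ∈ K.Traces, ∀ (π : PV) (i : ℕ), hl π ∈ σ i → hl π ∈ σ (i + 1))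
    (C : Config AP PV TV)
    (htr : ∀ π τ, (C.tr π τ).1 ∈ K.Traces ∧ (C.tr π τ).2 = 0)
    (hprog : ∀ j : ℕ, (C.iter j).halted hl ∨
      ∃ τ π, π ∈ (C.iter j).tj τ 0 ∧
        hl π ∉ ((C.iter j).tr π τ).1 ((C.iter j).tr π τ).2) :
    ∀ j : ℕ, K₀ * Fintype.card PV * Fintype.card TV ≤ j → (C.iter j).halted hl := by
  have hstep : ∀ j, C.iter (j + 1) = (C.iter j).step := fun j => by
    simp only [Config.iter, Function.iterate_succ_apply']
  have hmem : ∀ j π τ, ((C.iter j).tr π τ).1 ∈ K.Traces := by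
    intro j π τ
    induction j with
    | zero => exact (htr π τ).1
    | succ j ih =>
      rw [hstep]
      simp only [Config.step]
      split_ifs
      · exact ih
      · exact ih
  have hK : ∀ σ ∈ K.Traces, ∀ (π : PV) (i : ℕ), K₀ ≤ i → hl π ∈ σ i := by
    intro σ hσ π i hi
    obtain ⟨p, hp, hL⟩ := id hσ
    obtain ⟨n, hn, ht⟩ := hdepth p hp
    have h0 : hl π ∈ σ n := by
      rw [hL]
      exact hhalt _ ht π
    exact Nat.le_induction (P := fun m _ => hl π ∈ σ m) h0
      (fun m _ hm => hpersist σ hσ π m hm) i (hn.trans hi)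
  have hpers : ∀ j, (C.iter j).halted hl → (C.iter (j + 1)).halted hl := by
    intro j h π τ
    rw [hstep]
    simp only [Config.step]
    split_ifs
    · exact hpersist _ (hmem j π τ) π _ (h π τ)
    · exact h π τ
  have hmono : ∀ j π τ, ((C.iter j).tr π τ).2 ≤ ((C.iter (j + 1)).tr π τ).2 := by
    intro j π τ
    rw [hstep]
    simp only [Config.step]
    split_ifs <;> simp
  have key : ∀ j, (C.iter j).halted hl ∨
      j ≤ ∑ x : PV × TV, min ((C.iter j).tr x.1 x.2).2 K₀ := by
    intro j
    induction j with
    | zero => right; exact Nat.zero_le _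
    | succ j ih =>
      rcases hprog j with h | ⟨τ, π, hm, hn⟩
      · exact Or.inl (hpers j h)
      rcases ih with h | h
      · exact Or.inl (hpers j h)
      right
      refine Nat.succ_le_of_lt (lt_of_le_of_lt h ?_)
      apply Finset.sum_lt_sum
      · intro x _
        exact min_le_min_right _ (hmono j x.1 x.2)
      · refine ⟨(π, τ), Finset.mem_univ _, ?_⟩
        have hlt : ((C.iter j).tr π τ).2 < K₀ := by
          by_contra hc
          exact hn (hK _ (hmem j π τ) π _ (not_lt.mp hc))
        rw [hstep]
        simp only [Config.step, if_pos hm]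
        omega
  intro j hj
  rcases key j with h | h
  · exact h
  intro π τ
  by_contra hn
  have hlt : ((C.iter j).tr π τ).2 < K₀ := by
    by_contra hc
    exact hn (hK _ (hmem j π τ) π _ (not_lt.mp hc))
  have hS : ∑ x : PV × TV, min ((C.iter j).tr x.1 x.2).2 K₀ < ∑ _x : PV × TV, K₀ := by
    apply Finset.sum_lt_sum
    · intro x _
      exact min_le_right _ _
    · exact ⟨(π, τ), Finset.mem_univ _, lt_of_le_of_lt (min_le_left _ _) hlt⟩
  have hB : ∑ _x : PV × TV, K₀ = K₀ * Fintype.card PV * Fintype.card TV := by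
    simp only [Finset.sum_const, Finset.card_univ, Fintype.card_prod, smul_eq_mul]
    ring
  omega
end

section
/- Stutter invariance of next-free quantifier-free A-HLTL formulas: Let ψ be a quantifier-free extended A-HLTL formula (built from atoms a_{π,τ}, ¬, ∨, ∧, U, R; in particular containing no next operator), let Π be an asynchronous trace assignment and Γ a trajectory assignment for the variables of ψ. If Γ(τ)(0) = ∅ for every trajectory variable τ of ψ (i.e., at the current position every trajectory stutters every trace), then (Π,Γ) ⊨ ψ if and only if (Π,Γ)+1 ⊨ ψ. -/
open Classical

universe u v w

/-- Quantifier-free extended A-HLTL formulas, built from atoms, negation,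
disjunction, conjunction, until and release; there is no next operator. -/
inductive QF (AP : Type u) (PV : Type v) (TV : Type w) : Type (max u v w) where
  | tt : QF AP PV TV
  | atom (a : AP) (π : PV) (τ : TV) : QF AP PV TV
  | neg (ψ : QF AP PV TV) : QF AP PV TV
  | or (ψ₁ ψ₂ : QF AP PV TV) : QF AP PV TV
  | and (ψ₁ ψ₂ : QF AP PV TV) : QF AP PV TV
  | until_ (ψ₁ ψ₂ : QF AP PV TV) : QF AP PV TV
  | release (ψ₁ ψ₂ : QF AP PV TV) : QF AP PV TV

/-- Satisfaction of quantifier-free formulas. -/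
def QF.sat {AP : Type u} {PV : Type v} {TV : Type w} :
    QF AP PV TV → Config AP PV TV → Prop
  | .tt, _ => True
  | .atom a π τ, C => a ∈ (C.tr π τ).1 (C.tr π τ).2
  | .neg ψ, C => ¬ ψ.sat C
  | .or ψ₁ ψ₂, C => ψ₁.sat C ∨ ψ₂.sat C
  | .and ψ₁ ψ₂, C => ψ₁.sat C ∧ ψ₂.sat C
  | .until_ ψ₁ ψ₂, C => ∃ i, ψ₂.sat (C.iter i) ∧ ∀ j < i, ψ₁.sat (C.iter j)
  | .release ψ₁ ψ₂, C =>
      (∀ i, ψ₂.sat (C.iter i)) ∨ ∃ i, ψ₁.sat (C.iter i) ∧ ∀ j ≤ i, ψ₂.sat (C.iter j)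

/-- Trajectory variables occurring in a quantifier-free formula. -/
def QF.tvars {AP : Type u} {PV : Type v} {TV : Type w} : QF AP PV TV → Set TV
  | .tt => ∅
  | .atom _ _ τ => {τ}
  | .neg ψ => ψ.tvars
  | .or ψ₁ ψ₂ => ψ₁.tvars ∪ ψ₂.tvars
  | .and ψ₁ ψ₂ => ψ₁.tvars ∪ ψ₂.tvars
  | .until_ ψ₁ ψ₂ => ψ₁.tvars ∪ ψ₂.tvars
  | .release ψ₁ ψ₂ => ψ₁.tvars ∪ ψ₂.tvars

/-- stutter invariance of next-free quantifier-free A-HLTL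
formulas.  If at the current position every trajectory variable of `ψ`
stutters every trace (`Γ(τ)(0) = ∅`), then `(Π,Γ) ⊨ ψ ↔ (Π,Γ)+1 ⊨ ψ`. -/
theorem stutter_invariance {AP : Type u} {PV : Type v} {TV : Type w}
    (ψ : QF AP PV TV) (C : Config AP PV TV)
    (hstut : ∀ τ ∈ ψ.tvars, C.tj τ 0 = ∅) :
    ψ.sat C ↔ ψ.sat C.step := by
  induction ψ with
  | tt => exact Iff.rfl
  | atom a π τ =>
    have h := hstut τ rfl
    simp [QF.sat, Config.step, h]
  | neg ψ ih => exact not_congr (ih hstut)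
  | or ψ₁ ψ₂ ih₁ ih₂ =>
    exact or_congr (ih₁ fun τ h => hstut τ (Or.inl h)) (ih₂ fun τ h => hstut τ (Or.inr h))
  | and ψ₁ ψ₂ ih₁ ih₂ =>
    exact and_congr (ih₁ fun τ h => hstut τ (Or.inl h)) (ih₂ fun τ h => hstut τ (Or.inr h))
  | until_ ψ₁ ψ₂ ih₁ ih₂ =>
    have h₁ := ih₁ fun τ h => hstut τ (Or.inl h)
    have h₂ := ih₂ fun τ h => hstut τ (Or.inr h)
    simp only [QF.sat]
    constructor
    · rintro ⟨_ | i, hi, hj⟩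
      · exact ⟨0, h₂.1 hi, fun j hj => absurd hj (Nat.not_lt_zero j)⟩
      · exact ⟨i, hi, fun j hji => hj (j + 1) (Nat.succ_lt_succ hji)⟩
    · rintro ⟨_ | i, hi, hj⟩
      · exact ⟨0, h₂.2 hi, fun j hj => absurd hj (Nat.not_lt_zero j)⟩
      · refine ⟨i + 2, hi, ?_⟩
        rintro (_ | j) hji
        · exact h₁.2 (hj 0 (Nat.succ_pos i))
        · exact hj j (Nat.lt_of_succ_lt_succ hji)
  | release ψ₁ ψ₂ ih₁ ih₂ =>
    have h₁ := ih₁ fun τ h => hstut τ (Or.inl h)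
    have h₂ := ih₂ fun τ h => hstut τ (Or.inr h)
    simp only [QF.sat]
    constructor
    · rintro (h | ⟨_ | i, hi, hj⟩)
      · exact Or.inl fun i => h (i + 1)
      · refine Or.inr ⟨0, h₁.1 hi, fun j hj0 => ?_⟩
        obtain rfl := Nat.le_zero.1 hj0
        exact h₂.1 (hj 0 le_rfl)
      · exact Or.inr ⟨i, hi, fun j hji => hj (j + 1) (Nat.succ_le_succ hji)⟩
    · rintro (h | ⟨i, hi, hj⟩)
      · left
        rintro (_ | i)
        · exact h₂.2 (h 0)
        · exact h i
      · refine Or.inr ⟨i + 1, hi, ?_⟩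
        rintro (_ | j) hji
        · exact h₂.2 (hj 0 (Nat.zero_le i))
        · exact hj j (Nat.le_of_succ_le_succ hji)
end
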